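/- Suppose a⁰,a¹ : ℕ → ℂ² satisfy condition (A) and conditions (C1)–(C5), that 0 < ‖a⁰₀‖ < 1, that ⟨a⁰₁, a⁰₀⟩ ≠ 0 and that ⟨a¹₀, a⁰₀⟩ = 0. Set ρ := ‖a⁰₀‖. Then: ‖a¹₀‖ = 1; a¹_k = 0 for every k ≥ 1; and there exists θ ∈ ℝ such that a⁰_p = (−ρ·e^{iθ})^{p−1}·e^{iθ}·((1−ρ²)/ρ)·a⁰₀ for every p ≥ 1. (That is, the corresponding M⁺-inner matrix function is of Type 4.) -/

import Mathlib

open Finset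

/-- `ℂ²` with its Euclidean structure. -/
abbrev E2 := EuclideanSpace ℂ (Fin 2)

/-- The inner product of `ℂ²`: `⟨u,v⟩ = u⁽¹⁾conj(v⁽¹⁾) + u⁽²⁾conj(v⁽²⁾)`. -/
noncomputable def cinner (u v : E2) : ℂ := ∑ i, u i * (starRingEnd ℂ) (v i)

/-- Condition (A). -/
def condA (a0 a1 : ℕ → E2) : Prop :=
  (∀ m : ℕ, (∑' k : ℕ, cinner (a0 (k + m)) (a0 k)) = if m = 0 then 1 else 0) ∧
  (∀ m : ℕ, (∑' k : ℕ, cinner (a1 (k + m)) (a1 k)) = if m = 0 then 1 else 0) ∧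
  (∀ m : ℕ, (∑' k : ℕ, cinner (a0 (k + m)) (a1 k)) = 0) ∧
  (∀ m : ℕ, (∑' k : ℕ, cinner (a1 (k + m)) (a0 k)) = 0)

/-- Conditions (C1)–(C5), with `d := 1 − ‖a0 0‖²`. -/
def condC (a0 a1 : ℕ → E2) : Prop :=
  (∀ p : ℕ, 1 ≤ p → ‖cinner (a0 p) (a0 0)‖ ^ 2
      = (1 - ‖a0 0‖ ^ 2) * (1 - ∑ k ∈ Finset.range (p + 1), ‖a0 k‖ ^ 2)) ∧
  (∀ p : ℕ, ‖cinner (a1 p) (a0 0)‖ ^ 2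
      = (1 - ‖a0 0‖ ^ 2) * (1 - ∑ k ∈ Finset.range (p + 1), ‖a1 k‖ ^ 2)) ∧
  (∀ p p' : ℕ, 0 < p → p < p' →
    cinner (a0 p') (a0 0) * cinner (a0 0) (a0 p)
      = -((1 - ‖a0 0‖ ^ 2 : ℝ) : ℂ) *
          ∑ r ∈ Finset.range (p + 1), cinner (a0 (p' - r)) (a0 (p - r))) ∧
  (∀ p p' : ℕ, p < p' →
    cinner (a1 p') (a0 0) * cinner (a0 0) (a1 p)
      = -((1 - ‖a0 0‖ ^ 2 : ℝ) : ℂ) *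
          ∑ r ∈ Finset.range (p + 1), cinner (a1 (p' - r)) (a1 (p - r))) ∧
  (∀ p p' : ℕ, 0 < p → p ≤ p' →
    cinner (a1 p') (a0 0) * cinner (a0 0) (a0 p)
      = -((1 - ‖a0 0‖ ^ 2 : ℝ) : ℂ) *
          ∑ r ∈ Finset.range (p + 1), cinner (a1 (p' - r)) (a0 (p - r))) ∧
  (∀ p p' : ℕ, p' < p →
    cinner (a1 p') (a0 0) * cinner (a0 0) (a0 p)
      = -((1 - ‖a0 0‖ ^ 2 : ℝ) : ℂ) *
          ∑ r ∈ Finset.range (p' + 1), cinner (a1 (p' - r)) (a0 (p - r)))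

lemma cinner_eq (u v : E2) :
    cinner u v = u 0 * (starRingEnd ℂ) (v 0) + u 1 * (starRingEnd ℂ) (v 1) := by
  simp [cinner, Fin.sum_univ_two]

lemma cinner_smul_left (c : ℂ) (u v : E2) : cinner (c • u) v = c * cinner u v := by
  simp only [cinner_eq, PiLp.smul_apply, smul_eq_mul]; ring

lemma cinner_smul_right (c : ℂ) (u v : E2) :
    cinner u (c • v) = (starRingEnd ℂ) c * cinner u v := by
  simp only [cinner_eq, PiLp.smul_apply, smul_eq_mul, map_mul]; ring

lemma cinner_self (u : E2) : cinner u u = ((‖u‖ ^ 2 : ℝ) : ℂ) := by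
  rw [cinner_eq, EuclideanSpace.norm_sq_eq, Fin.sum_univ_two, Complex.mul_conj', Complex.mul_conj']
  push_cast
  rfl

/-- In `ℂ²`, two vectors orthogonal to a common nonzero vector are proportional. -/
lemma exists_eq_smul_of_cinner_eq_zero {w u v : E2} (hw : w ≠ 0) (hu : u ≠ 0)
    (hwu : cinner w u = 0) (hwv : cinner w v = 0) : ∃ c : ℂ, v = c • u := by
  rw [cinner_eq] at hwu hwv
  have hdet : (starRingEnd ℂ) (v 0) * (starRingEnd ℂ) (u 1)
      = (starRingEnd ℂ) (v 1) * (starRingEnd ℂ) (u 0) := by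
    by_cases h0 : w 0 = 0
    · have h1 : w 1 ≠ 0 := by
        intro h1
        apply hw
        ext i
        fin_cases i <;> simp [h0, h1]
      apply mul_left_cancel₀ h1
      linear_combination (starRingEnd ℂ) (v 0) * hwu - (starRingEnd ℂ) (u 0) * hwv
    · apply mul_left_cancel₀ h0
      linear_combination (starRingEnd ℂ) (u 1) * hwv - (starRingEnd ℂ) (v 1) * hwu
  have hdet' : v 0 * u 1 = v 1 * u 0 := by
    simpa using congrArg (starRingEnd ℂ) hdet
  by_cases h0 : u 0 = 0
  · have h1 : u 1 ≠ 0 := by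
      intro h1
      apply hu
      ext i
      fin_cases i <;> simp [h0, h1]
    have hv0 : v 0 = 0 := by simpa [h0, h1] using hdet'
    refine ⟨v 1 / u 1, ?_⟩
    ext i
    fin_cases i <;> simp [h0, h1, hv0]
  · refine ⟨v 0 / u 0, ?_⟩
    ext i
    fin_cases i
    · simp [h0]
    · simp only [Fin.mk_one, PiLp.smul_apply, smul_eq_mul]
      field_simp
      linear_combination -hdet'

theorem stmt15 (a0 a1 : ℕ → E2) (hA : condA a0 a1) (hC : condC a0 a1)
    (h00 : 0 < ‖a0 0‖) (h01 : ‖a0 0‖ < 1)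
    (hC2 : cinner (a0 1) (a0 0) ≠ 0) (hC3 : cinner (a1 0) (a0 0) = 0) :
    ‖a1 0‖ = 1 ∧ (∀ k : ℕ, 1 ≤ k → a1 k = 0) ∧
    (∃ θ : ℝ, ∀ p : ℕ, 1 ≤ p →
      a0 p = ((-((‖a0 0‖ : ℝ) : ℂ) * Complex.exp ((θ : ℂ) * Complex.I)) ^ (p - 1) *
        Complex.exp ((θ : ℂ) * Complex.I) *
        (((1 - ‖a0 0‖ ^ 2) / ‖a0 0‖ : ℝ) : ℂ)) • a0 0) := by
  obtain ⟨c1, c2, c3, -, -, c5⟩ := hC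
  have hu : a0 0 ≠ 0 := norm_pos_iff.1 h00
  obtain ⟨ρ, hρ⟩ : ∃ ρ, ρ = ‖a0 0‖ := ⟨_, rfl⟩
  have hself : cinner (a0 0) (a0 0) = (ρ : ℂ) ^ 2 := by
    rw [cinner_self, hρ]; push_cast; rfl
  simp only [← hρ] at c1 c2 c3 c5 h00 h01 ⊢
  have hd : 0 < 1 - ρ ^ 2 := by nlinarith
  have hdC : ((1 - ρ ^ 2 : ℝ) : ℂ) ≠ 0 := by exact_mod_cast hd.ne'
  have hρC : (ρ : ℂ) ≠ 0 := by exact_mod_cast h00.ne'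
  have hw2 : ‖a1 0‖ ^ 2 = 1 := by
    have h := c2 0
    simp only [hC3, norm_zero, zero_add, Finset.sum_range_one] at h
    nlinarith
  have hw : ‖a1 0‖ = 1 := by
    nlinarith [norm_nonneg (a1 0)]
  have hw0 : a1 0 ≠ 0 := by
    intro h; simp [h] at hw
  refine ⟨hw, ?_, ?_⟩
  · intro k hk
    have h := c2 k
    have hle : ‖a1 0‖ ^ 2 + ‖a1 k‖ ^ 2 ≤ ∑ j ∈ Finset.range (k + 1), ‖a1 j‖ ^ 2 := by
      rw [Finset.sum_range_succ]
      gcongr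
      exact Finset.single_le_sum (f := fun j => ‖a1 j‖ ^ 2) (fun j _ => sq_nonneg _)
        (Finset.mem_range.2 hk)
    have hn : ‖a1 k‖ ^ 2 = 0 := by
      nlinarith [sq_nonneg ‖a1 k‖, sq_nonneg ‖cinner (a1 k) (a0 0)‖]
    simpa using hn
  have horth : ∀ p, 0 < p → ∃ c : ℂ, a0 p = c • a0 0 := by
    intro p hp
    apply exists_eq_smul_of_cinner_eq_zero hw0 hu hC3
    have h := c5 p 0 hp
    rw [hC3, zero_mul] at h
    simpa using (mul_eq_zero.1 h.symm).resolve_left (neg_ne_zero.2 hdC)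
  choose! c hc using horth
  have hnorm : ‖c 1‖ = (1 - ρ ^ 2) / ρ := by
    have h := c1 1 le_rfl
    rw [Finset.sum_range_succ, Finset.sum_range_one, hc 1 one_pos, cinner_smul_left, hself,
      norm_smul, norm_mul, norm_pow, Complex.norm_real, Real.norm_of_nonneg h00.le, ← hρ] at h
    rw [eq_div_iff h00.ne']
    apply (pow_left_inj₀ (by positivity) hd.le two_ne_zero).1
    linear_combination h
  have hpolar : c 1 = Complex.exp ((Complex.arg (c 1) : ℂ) * Complex.I) *
      (((1 - ρ ^ 2) / ρ : ℝ) : ℂ) := by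
    rw [← hnorm, mul_comm, Complex.norm_mul_exp_arg_mul_I]
  have hconj : (starRingEnd ℂ) (c 1) * c 1 = (((1 - ρ ^ 2) / ρ : ℝ) : ℂ) ^ 2 := by
    rw [Complex.conj_mul', hnorm]
  obtain ⟨e, he⟩ : ∃ e, e = Complex.exp ((Complex.arg (c 1) : ℂ) * Complex.I) := ⟨_, rfl⟩
  refine ⟨Complex.arg (c 1), fun p hp => ?_⟩
  rw [← he] at hpolar ⊢
  have hstep : ∀ p, 1 ≤ p → c (p + 1) = (-(ρ : ℂ) * e) * c p := by
    intro p hp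
    have h := c3 1 (p + 1) one_pos (by omega)
    rw [Finset.sum_range_succ, Finset.sum_range_one] at h
    simp only [Nat.sub_zero, Nat.add_sub_cancel, Nat.sub_self, hc 1 one_pos, hc p hp,
      hc (p + 1) (by omega), cinner_smul_left, cinner_smul_right, hself] at h
    have h2 : c (p + 1) * (starRingEnd ℂ) (c 1) = -((1 - ρ ^ 2 : ℝ) : ℂ) * c p := by
      apply mul_left_cancel₀ (pow_ne_zero 2 hρC)
      push_cast at h ⊢
      linear_combination h
    apply mul_right_cancel₀ (pow_ne_zero 2 hdC)
    have h3 : c (p + 1) * (((1 - ρ ^ 2) / ρ : ℝ) : ℂ) ^ 2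
        = -((1 - ρ ^ 2 : ℝ) : ℂ) * c p * (e * (((1 - ρ ^ 2) / ρ : ℝ) : ℂ)) := by
      rw [← hpolar, ← hconj]
      linear_combination c 1 * h2
    push_cast at h3 ⊢
    field_simp at h3
    linear_combination h3
  rw [hc p hp, mul_assoc, ← hpolar]
  congr 1
  induction p, hp using Nat.le_induction with
  | base => simp
  | succ n hn ih =>
    rw [hstep n hn, ih]
    obtain ⟨k, rfl⟩ : ∃ k, n = k + 1 := ⟨n - 1, by omega⟩
    simp only [Nat.add_sub_cancel]
    ring
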